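/- Let G be a graph on vertex set {1,...,n}, let {V₁, V₂} be highly regular for G, and assume the induced subgraph G[V₁ ∪ V₂] is regular. Then there exists c* ∈ ℝ such that: if c = c*, then gKKT_c(G) ∩ [x^{V₁}, x^{V₂}] = [x^{V₁}, x^{V₂}] (the whole segment); and if c ≠ c*, then gKKT_c(G) ∩ [x^{V₁}, x^{V₂}] = {x^{V₁}, x^{V₂}, x^{V₁∪V₂}}, where [x^{V₁}, x^{V₂}] denotes the convex hull of x^{V₁} and x^{V₂}. -/

import Mathlib

open Matrix BigOperators

/-- The characteristic vector of a non-empty set `S` of vertices: `1/|S|` on `S`, `0` elsewhere. -/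
noncomputable def charVec {n : ℕ} (S : Finset (Fin n)) : Fin n → ℝ :=
  fun i => if i ∈ S then ((S.card : ℝ))⁻¹ else 0

/-- The set of generalized KKT points of the parametric Motzkin–Straus program. -/
def gKKT {n : ℕ} (A : Matrix (Fin n) (Fin n) ℝ) (c : ℝ) : Set (Fin n → ℝ) :=
  {x | x ∈ stdSimplex ℝ (Fin n) ∧
    ∃ lam : ℝ, ∀ i, x i ≠ 0 → ((A + c • 1) *ᵥ x) i = lam}

/-- `e_G(S₁,S₂)`: the number of ordered pairs of adjacent vertices in `S₁ × S₂`. -/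
noncomputable def eG {n : ℕ} (A : Matrix (Fin n) (Fin n) ℝ) (S₁ S₂ : Finset (Fin n)) : ℕ :=
  ((S₁ ×ˢ S₂).filter (fun p => A p.1 p.2 = 1)).card

/-- The edge density `d_G(S₁,S₂) = e_G(S₁,S₂)/(|S₁||S₂|)`. -/
noncomputable def dG {n : ℕ} (A : Matrix (Fin n) (Fin n) ℝ) (S₁ S₂ : Finset (Fin n)) : ℝ :=
  (eG A S₁ S₂ : ℝ) / ((S₁.card : ℝ) * (S₂.card : ℝ))

lemma charVec_mem_stdSimplex {n : ℕ} {S : Finset (Fin n)} (hS : S.Nonempty) :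
    charVec S ∈ stdSimplex ℝ (Fin n) := by
  have hS' : (S.card : ℝ) ≠ 0 := by exact_mod_cast hS.card_pos.ne'
  refine ⟨fun i => ?_, ?_⟩
  · unfold charVec
    split_ifs <;> positivity
  · simp [charVec, hS']

/-- The row sum of a 0-1 matrix over `S` counts the ones of that row in `S`. -/
lemma card_filter_eq_sum {n : ℕ} {A : Matrix (Fin n) (Fin n) ℝ}
    (h01 : ∀ i j, A i j = 0 ∨ A i j = 1) (S : Finset (Fin n)) (i : Fin n) :
    ((S.filter (fun j => A i j = 1)).card : ℝ) = ∑ j ∈ S, A i j := by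
  rw [Finset.card_filter]
  push_cast
  refine Finset.sum_congr rfl fun j _ => ?_
  rcases h01 i j with h | h <;> simp [h]

lemma dG_singleton {n : ℕ} {A : Matrix (Fin n) (Fin n) ℝ}
    (h01 : ∀ i j, A i j = 0 ∨ A i j = 1) (S : Finset (Fin n)) (i : Fin n) :
    dG A {i} S = (∑ j ∈ S, A i j) / S.card := by
  rw [← card_filter_eq_sum h01]
  simp only [dG, eG, Finset.card_singleton, Nat.cast_one, one_mul]
  congr 2
  rw [Finset.singleton_product, Finset.filter_map, Finset.card_map]
  rfl

lemma mulVec_charVec {n : ℕ} {A : Matrix (Fin n) (Fin n) ℝ}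
    (h01 : ∀ i j, A i j = 0 ∨ A i j = 1) (S : Finset (Fin n)) (i : Fin n) :
    (A *ᵥ charVec S) i = dG A {i} S := by
  rw [dG_singleton h01]
  simp [Matrix.mulVec, dotProduct, charVec, div_eq_mul_inv, Finset.sum_mul]

lemma charVec_union {n : ℕ} {V₁ V₂ : Finset (Fin n)} (hn1 : V₁.Nonempty) (hn2 : V₂.Nonempty)
    (hdisj : Disjoint V₁ V₂) :
    charVec (V₁ ∪ V₂) = ((V₁.card : ℝ) / (V₁.card + V₂.card)) • charVec V₁ +
      ((V₂.card : ℝ) / (V₁.card + V₂.card)) • charVec V₂ := by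
  have hp : (0 : ℝ) < V₁.card := by exact_mod_cast hn1.card_pos
  have hq : (0 : ℝ) < V₂.card := by exact_mod_cast hn2.card_pos
  ext i
  have hnot : i ∈ V₁ → i ∉ V₂ := fun h => Finset.disjoint_left.mp hdisj h
  simp only [charVec, Finset.mem_union, Finset.card_union_of_disjoint hdisj, Pi.add_apply,
    Pi.smul_apply, smul_eq_mul, Nat.cast_add]
  by_cases h1 : i ∈ V₁
  · simp only [h1, hnot h1, true_or, if_true, if_false]
    field_simp
    simp
  · by_cases h2 : i ∈ V₂
    · simp only [h1, h2, or_true, if_true, if_false]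
      field_simp
      simp
    · simp [h1, h2]

/-- A point of the segment between two characteristic vectors of a highly regular pair is a
generalized KKT point iff it is an endpoint or the two values of `(A + cI)x` agree. -/
lemma mem_gKKT_segment_iff {n : ℕ} {A : Matrix (Fin n) (Fin n) ℝ}
    (h01 : ∀ i j, A i j = 0 ∨ A i j = 1)
    {V₁ V₂ : Finset (Fin n)} (hn1 : V₁.Nonempty) (hn2 : V₂.Nonempty)
    (hdisj : Disjoint V₁ V₂)
    (h11 : ∀ i ∈ V₁, dG A V₁ V₁ = dG A {i} V₁)
    (h12 : ∀ i ∈ V₁, dG A V₁ V₂ = dG A {i} V₂)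
    (h21 : ∀ i ∈ V₂, dG A V₂ V₁ = dG A {i} V₁)
    (h22 : ∀ i ∈ V₂, dG A V₂ V₂ = dG A {i} V₂)
    (c : ℝ) {a b : ℝ} (ha : 0 ≤ a) (hb : 0 ≤ b) (hab : a + b = 1) :
    a • charVec V₁ + b • charVec V₂ ∈ gKKT A c ↔
      a = 0 ∨ b = 0 ∨
        a * dG A V₁ V₁ + b * dG A V₁ V₂ + c * (a / V₁.card) =
          a * dG A V₂ V₁ + b * dG A V₂ V₂ + c * (b / V₂.card) := by
  have hp : (V₁.card : ℝ) ≠ 0 := by exact_mod_cast hn1.card_pos.ne'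
  have hq : (V₂.card : ℝ) ≠ 0 := by exact_mod_cast hn2.card_pos.ne'
  set x := a • charVec V₁ + b • charVec V₂ with hx
  have hx1 : ∀ i ∈ V₁, x i = a / V₁.card := fun i hi => by
    simp [hx, charVec, hi, Finset.disjoint_left.mp hdisj hi, div_eq_mul_inv]
  have hx2 : ∀ i ∈ V₂, x i = b / V₂.card := fun i hi => by
    simp [hx, charVec, hi, Finset.disjoint_right.mp hdisj hi, div_eq_mul_inv]
  have hx0 : ∀ i, x i ≠ 0 → (i ∈ V₁ ∧ a ≠ 0) ∨ (i ∈ V₂ ∧ b ≠ 0) := by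
    intro i hi
    by_cases h1 : i ∈ V₁
    · exact .inl ⟨h1, fun h => hi (by rw [hx1 i h1, h, zero_div])⟩
    · by_cases h2 : i ∈ V₂
      · exact .inr ⟨h2, fun h => hi (by rw [hx2 i h2, h, zero_div])⟩
      · exact absurd (by simp [hx, charVec, h1, h2]) hi
  have hval : ∀ i, ((A + c • 1) *ᵥ x) i = a * dG A {i} V₁ + b * dG A {i} V₂ + c * x i := by
    intro i
    rw [Matrix.add_mulVec, Matrix.smul_mulVec, Matrix.one_mulVec, Pi.add_apply, Pi.smul_apply,
      smul_eq_mul]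
    congr 1
    rw [hx, Matrix.mulVec_add, Matrix.mulVec_smul, Matrix.mulVec_smul]
    simp [mulVec_charVec h01]
  have hval1 : ∀ i ∈ V₁, ((A + c • 1) *ᵥ x) i =
      a * dG A V₁ V₁ + b * dG A V₁ V₂ + c * (a / V₁.card) := fun i hi => by
    rw [hval, hx1 i hi, h11 i hi, h12 i hi]
  have hval2 : ∀ i ∈ V₂, ((A + c • 1) *ᵥ x) i =
      a * dG A V₂ V₁ + b * dG A V₂ V₂ + c * (b / V₂.card) := fun i hi => by
    rw [hval, hx2 i hi, h21 i hi, h22 i hi]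
  have hsimplex : x ∈ stdSimplex ℝ (Fin n) :=
    convex_stdSimplex ℝ (Fin n) (charVec_mem_stdSimplex hn1) (charVec_mem_stdSimplex hn2)
      ha hb hab
  constructor
  · rintro ⟨-, lam, hlam⟩
    by_cases ha0 : a = 0
    · exact .inl ha0
    by_cases hb0 : b = 0
    · exact .inr (.inl hb0)
    obtain ⟨i, hi⟩ := hn1
    obtain ⟨j, hj⟩ := hn2
    refine .inr (.inr ?_)
    rw [← hval1 i hi, ← hval2 j hj, hlam i (by rw [hx1 i hi]; exact div_ne_zero ha0 hp),
      hlam j (by rw [hx2 j hj]; exact div_ne_zero hb0 hq)]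
  · intro h
    refine ⟨hsimplex, ?_⟩
    rcases h with h | h | h
    · exact ⟨_, fun i hi => hval2 i ((hx0 i hi).resolve_left fun h' => h'.2 h).1⟩
    · exact ⟨_, fun i hi => hval1 i ((hx0 i hi).resolve_right fun h' => h'.2 h).1⟩
    · refine ⟨a * dG A V₁ V₁ + b * dG A V₁ V₂ + c * (a / V₁.card), fun i hi => ?_⟩
      rcases hx0 i hi with h' | h'
      · exact hval1 i h'.1
      · rw [hval2 i h'.1, h]

/-- Let `{V₁, V₂}` be highly regular for `G` with `G[V₁ ∪ V₂]` regular.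
Then there is a `c*` such that for `c = c*` the whole segment `[x^{V₁}, x^{V₂}]` consists of
generalized KKT points, while for `c ≠ c*` the generalized KKT points on the segment are
exactly `x^{V₁}`, `x^{V₂}` and `x^{V₁ ∪ V₂}`. -/
theorem gkkt_on_segment_of_regular
    (n : ℕ) (A : Matrix (Fin n) (Fin n) ℝ)
    (hsymm : A.IsSymm)
    (h01 : ∀ i j, A i j = 0 ∨ A i j = 1)
    (hdiag : ∀ i, A i i = 0)
    (V₁ V₂ : Finset (Fin n)) (hn1 : V₁.Nonempty) (hn2 : V₂.Nonempty)
    (hdisj : Disjoint V₁ V₂)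
    (h11 : ∀ i ∈ V₁, dG A V₁ V₁ = dG A {i} V₁)
    (h12 : ∀ i ∈ V₁, dG A V₁ V₂ = dG A {i} V₂)
    (h21 : ∀ i ∈ V₂, dG A V₂ V₁ = dG A {i} V₁)
    (h22 : ∀ i ∈ V₂, dG A V₂ V₂ = dG A {i} V₂)
    (hreg : ∃ d : ℕ, ∀ i ∈ V₁ ∪ V₂, ((V₁ ∪ V₂).filter (fun j => A i j = 1)).card = d) :
    ∃ cs : ℝ, ∀ c : ℝ,
      (c = cs → gKKT A c ∩ segment ℝ (charVec V₁) (charVec V₂) =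
        segment ℝ (charVec V₁) (charVec V₂)) ∧
      (c ≠ cs → gKKT A c ∩ segment ℝ (charVec V₁) (charVec V₂) =
        {charVec V₁, charVec V₂, charVec (V₁ ∪ V₂)}) := by
  have hp : (0 : ℝ) < V₁.card := by exact_mod_cast hn1.card_pos
  have hq : (0 : ℝ) < V₂.card := by exact_mod_cast hn2.card_pos
  have hdegree : (V₁.card : ℝ) * dG A V₁ V₁ + V₂.card * dG A V₁ V₂ =
      V₁.card * dG A V₂ V₁ + V₂.card * dG A V₂ V₂ := by
    obtain ⟨d, hd⟩ := hreg
    have hrow : ∀ i ∈ V₁ ∪ V₂,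
        (V₁.card : ℝ) * dG A {i} V₁ + V₂.card * dG A {i} V₂ = d := by
      intro i hi
      rw [← hd i hi, card_filter_eq_sum h01, Finset.sum_union hdisj, dG_singleton h01,
        dG_singleton h01, mul_div_cancel₀ _ hp.ne', mul_div_cancel₀ _ hq.ne']
    obtain ⟨i, hi⟩ := hn1
    obtain ⟨j, hj⟩ := hn2
    rw [h11 i hi, h12 i hi, h21 j hj, h22 j hj, hrow i (Finset.mem_union_left _ hi),
      hrow j (Finset.mem_union_right _ hj)]
  refine ⟨V₁.card * (dG A V₂ V₁ - dG A V₁ V₁), fun c => ?_⟩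
  have hmem : ∀ {a b : ℝ}, 0 ≤ a → 0 ≤ b → a + b = 1 →
      (a • charVec V₁ + b • charVec V₂ ∈ gKKT A c ↔ a = 0 ∨ b = 0 ∨
        (a * V₂.card - b * V₁.card) * (c - V₁.card * (dG A V₂ V₁ - dG A V₁ V₁)) = 0) := by
    intro a b ha hb hab
    rw [mem_gKKT_segment_iff h01 hn1 hn2 hdisj h11 h12 h21 h22 c ha hb hab]
    refine or_congr_right (or_congr_right ?_)
    generalize dG A V₁ V₁ = d₁₁ at *
    generalize dG A V₁ V₂ = d₁₂ at *
    generalize dG A V₂ V₁ = d₂₁ at *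
    generalize dG A V₂ V₂ = d₂₂ at *
    generalize (V₁.card : ℝ) = p at *
    generalize (V₂.card : ℝ) = q at *
    rw [← sub_eq_zero]
    have key : (a * q - b * p) * (c - p * (d₂₁ - d₁₁)) = p * q *
        (a * d₁₁ + b * d₁₂ + c * (a / p) - (a * d₂₁ + b * d₂₂ + c * (b / q))) := by
      field_simp
      linear_combination (-b * p) * hdegree
    rw [key, mul_eq_zero, or_iff_right (mul_pos hp hq).ne']
  constructor
  · rintro rfl
    refine Set.inter_eq_right.mpr ?_
    rintro _ ⟨a, b, ha, hb, hab, rfl⟩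
    exact (hmem ha hb hab).mpr (.inr (.inr (by rw [sub_self, mul_zero])))
  · intro hc
    have hmid := charVec_union hn1 hn2 hdisj
    apply Set.Subset.antisymm
    · rintro _ ⟨hx, a, b, ha, hb, hab, rfl⟩
      simp only [Set.mem_insert_iff, Set.mem_singleton_iff]
      rcases (hmem ha hb hab).mp hx with h | h | h
      · refine .inr (.inl ?_)
        rw [h, show b = 1 by linarith, zero_smul, one_smul, zero_add]
      · refine .inl ?_
        rw [h, show a = 1 by linarith, zero_smul, one_smul, add_zero]
      · refine .inr (.inr ?_)
        have h' := (mul_eq_zero.mp h).resolve_right (sub_ne_zero.mpr hc)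
        have ha' : a = V₁.card / (V₁.card + V₂.card) := by
          rw [eq_div_iff (by positivity)]
          linear_combination h' + V₁.card * hab
        have hb' : b = V₂.card / (V₁.card + V₂.card) := by
          rw [eq_div_iff (by positivity)]
          linear_combination -h' + V₂.card * hab
        rw [hmid, ha', hb']
    · have hends : ∀ {a b : ℝ}, 0 ≤ a → 0 ≤ b → a + b = 1 →
          (a = 0 ∨ b = 0 ∨ a * V₂.card - b * V₁.card = 0) →
          a • charVec V₁ + b • charVec V₂ ∈
            gKKT A c ∩ segment ℝ (charVec V₁) (charVec V₂) := fun ha hb hab h =>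
        ⟨(hmem ha hb hab).mpr (h.imp_right (Or.imp_right fun h => by rw [h, zero_mul])),
          _, _, ha, hb, hab, rfl⟩
      rintro _ (rfl | rfl | rfl)
      · simpa using hends zero_le_one le_rfl (add_zero 1) (.inr (.inl rfl))
      · simpa using hends le_rfl zero_le_one (zero_add 1) (.inl rfl)
      · rw [hmid]
        refine hends (by positivity) (by positivity) (by field_simp) (.inr (.inr ?_))
        ring
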